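/- Let J ∈ ℕ₀. For each f ∈ C^J(T^d) and g : T_n^d → ℝ, one has ‖ex_n(fg)‖_{H_J} ≤ C_J ‖ex_n f‖_{C^J} ‖ex_n g‖_{H_J}, where fg denotes the pointwise product of the restrictions to the discrete torus. -/

import Mathlib

open scoped BigOperators
open Real

noncomputable section

/-- The discrete `d`-dimensional torus with `(2n+1)^d` points. -/
abbrev DTorus (d n : ℕ) := Fin d → ZMod (2 * n + 1)

/-- Squared euclidean norm `|k|²` of a lattice vector `k ∈ ℤ^d`. -/
def latNormSq (d : ℕ) (k : Fin d → ℤ) : ℝ := ∑ j, ((k j : ℝ)) ^ 2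

/-- Sobolev weight `(1+|k|²)^J`. -/
def sobWeight (d : ℕ) (J : ℝ) (k : Fin d → ℤ) : ℝ := (1 + latNormSq d k) ^ J

/-- Squared Sobolev norm of an element of `H_J(T^d)` represented by its Fourier
coefficient sequence. -/
def sobNormSq (d : ℕ) (J : ℝ) (c : (Fin d → ℤ) → ℂ) : ℝ :=
  ∑' k, sobWeight d J k * ‖c k‖ ^ 2

/-- Sobolev norm. -/
def sobNorm (d : ℕ) (J : ℝ) (c : (Fin d → ℤ) → ℂ) : ℝ := Real.sqrt (sobNormSq d J c)

/-- The character `ς_k(y) = e^{i k·y}`. -/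
def charFun (d : ℕ) (k : Fin d → ℤ) (y : Fin d → ℝ) : ℂ :=
  Complex.exp (Complex.I * (∑ j, (k j : ℝ) * y j))

/-- The point of `T^d` corresponding to a lattice point of the discrete torus. -/
def discPt (d n : ℕ) (x : DTorus d n) : Fin d → ℝ :=
  fun j => 2 * π * ((x j).val : ℝ) / (2 * (n : ℝ) + 1)

/-- Normalized discrete inner product on `L_2(T_n^d)` (complex-valued version). -/
def dInner (d n : ℕ) (f g : DTorus d n → ℂ) : ℂ :=
  (((2 * (n : ℝ) + 1) ^ d : ℝ) : ℂ)⁻¹ * ∑ x : DTorus d n, f x * (starRingEnd ℂ) (g x)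

/-- Squared discrete `L²` norm `‖f‖²_n`. -/
def dNormSq (d n : ℕ) (f : DTorus d n → ℂ) : ℝ :=
  ((2 * (n : ℝ) + 1) ^ d)⁻¹ * ∑ x : DTorus d n, ‖f x‖ ^ 2

/-- Fourier coefficient sequence of the trigonometric interpolation
`ex_n f = Σ_{k ∈ {-n,…,n}^d} ⟨f, ς_k⟩_n ς_k`. -/
def exCoef (d n : ℕ) (f : DTorus d n → ℂ) : (Fin d → ℤ) → ℂ :=
  fun k => if ∀ j, |k j| ≤ (n : ℤ) then
    dInner d n f (fun x => charFun d k (discPt d n x)) else 0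

/-- Truncation of a coefficient sequence to the cube `{-n,…,n}^d` (i.e. `pr_n`). -/
def trunc (d n : ℕ) (c : (Fin d → ℤ) → ℂ) : (Fin d → ℤ) → ℂ :=
  fun k => if ∀ j, |k j| ≤ (n : ℤ) then c k else 0

/-- The cube `{-n,…,n}^d ⊂ ℤ^d`. -/
def cube (d n : ℕ) : Finset (Fin d → ℤ) :=
  Fintype.piFinset fun _ => Finset.Icc (-(n : ℤ)) (n : ℤ)

/-- The restriction of the Fourier projection `pr_n g` to the discrete torus. -/
def prDisc (d n : ℕ) (c : (Fin d → ℤ) → ℂ) : DTorus d n → ℂ :=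
  fun x => ∑ k ∈ cube d n, c k * charFun d k (discPt d n x)

/-- `L²(T^d)` inner product in Fourier coordinates. -/
def seqInner (d : ℕ) (c₁ c₂ : (Fin d → ℤ) → ℂ) : ℂ :=
  ∑' k, c₁ k * (starRingEnd ℂ) (c₂ k)

/-- The trigonometric interpolation `ex_n f` as a function on `T^d` (realized on `ℝ^d`). -/
def exFun (d n : ℕ) (f : DTorus d n → ℂ) : (Fin d → ℝ) → ℂ :=
  fun y => ∑ k ∈ cube d n, exCoef d n f k * charFun d k y

/-! ### One-dimensional finite differences of smooth functions -/

lemma fwdDiff_iter_bound (l : ℕ) : ∀ (φ : ℝ → ℂ) (M h : ℝ), 0 ≤ h → ContDiff ℝ ⊤ φ →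
    (∀ t, ‖iteratedDeriv l φ t‖ ≤ M) → ∀ t, ‖(fwdDiff h)^[l] φ t‖ ≤ M * h ^ l := by
  induction l with
  | zero => intro φ M h _ _ hM t; simpa using hM t
  | succ l ih =>
    intro φ M h hh hφ hM t
    rw [Function.iterate_succ_apply]
    have hshift : ContDiff ℝ ⊤ (fun z => φ (z + h)) := hφ.comp (contDiff_id.add contDiff_const)
    have hsm : ContDiff ℝ ⊤ (fwdDiff h φ) := hshift.sub hφ
    refine (ih (fwdDiff h φ) (M * h) h hh hsm ?_ t).trans (le_of_eq (by ring))
    intro t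
    have e : fwdDiff h φ = (fun z => φ (z + h)) - φ := rfl
    rw [e, iteratedDeriv_sub (hshift.contDiffAt.of_le le_top) (hφ.contDiffAt.of_le le_top),
      iteratedDeriv_comp_add_const]
    have := Convex.norm_image_sub_le_of_norm_deriv_le (𝕜 := ℝ) (f := iteratedDeriv l φ)
      (s := Set.univ) (x := t) (y := t + h) (C := M)
      (fun x _ => (hφ.differentiable_iteratedDeriv l (by exact WithTop.coe_lt_top _)) x)
      (fun x _ => by rw [← iteratedDeriv_succ]; exact hM x) convex_univ trivial trivial
    simpa [abs_of_nonneg hh] using this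

lemma iteratedDeriv_line_bound (d : ℕ) (F : (Fin d → ℝ) → ℂ) (hF : ContDiff ℝ ⊤ F) (l : ℕ)
    (M : ℝ) (hM : ∀ y, ‖iteratedFDeriv ℝ l F y‖ ≤ M) (j : Fin d) (y : Fin d → ℝ) (t : ℝ) :
    ‖iteratedDeriv l (fun s : ℝ => F (y + s • Pi.single j (1 : ℝ))) t‖ ≤ M := by
  let e : ℝ →L[ℝ] (Fin d → ℝ) := ContinuousLinearMap.toSpanSingleton ℝ (Pi.single j (1 : ℝ))
  have h1 : (fun s : ℝ => F (y + s • Pi.single j (1 : ℝ))) = (fun z => F (y + z)) ∘ e := by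
    funext s; simp [e]
  have hs : ContDiff ℝ ⊤ (fun z => F (y + z)) := hF.comp (contDiff_const.add contDiff_id)
  rw [h1, iteratedDeriv_eq_iteratedFDeriv, e.iteratedFDeriv_comp_right hs t (i := l) le_top,
    iteratedFDeriv_comp_add_left]
  rw [ContinuousMultilinearMap.compContinuousLinearMap_apply]
  refine (ContinuousMultilinearMap.le_opNorm _ _).trans ?_
  have h2 : ‖e 1‖ = 1 := by
    simp only [e, ContinuousLinearMap.toSpanSingleton_apply, one_smul]
    rw [Pi.norm_single, norm_one]
  simp only [h2, Finset.prod_const_one, mul_one]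
  exact hM _

lemma contDiff_exFun (d n : ℕ) (f : DTorus d n → ℂ) : ContDiff ℝ ⊤ (exFun d n f) := by
  unfold exFun charFun
  refine ContDiff.sum fun k _ => contDiff_const.mul ?_
  refine ContDiff.cexp (contDiff_const.mul ?_)
  push_cast
  refine ContDiff.sum fun j _ => contDiff_const.mul ?_
  exact Complex.ofRealCLM.contDiff.comp (contDiff_apply ℝ ℝ j)

/-! ### Characters on the grid -/

lemma charFun_grid (d n : ℕ) (k a : Fin d → ℤ) :
    charFun d k (fun j => 2 * π * (a j : ℝ) / (2 * (n : ℝ) + 1))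
      = ∏ j, ZMod.stdAddChar (N := 2 * n + 1) ((k j : ZMod (2 * n + 1)) * (a j : ZMod (2*n+1))) := by
  unfold charFun
  have : ∀ j, ZMod.stdAddChar (N := 2 * n + 1) ((k j : ZMod (2 * n + 1)) * (a j : ZMod (2*n+1)))
      = Complex.exp (2 * π * Complex.I * ((k j * a j : ℤ) : ℂ) / ((2 * n + 1 : ℕ) : ℂ)) := by
    intro j
    rw [← ZMod.stdAddChar_coe]; push_cast; rfl
  simp_rw [this]
  rw [← Complex.exp_sum]
  congr 1
  push_cast
  rw [Finset.mul_sum]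
  refine Finset.sum_congr rfl fun j _ => ?_
  ring

lemma charFun_discPt (d n : ℕ) (k : Fin d → ℤ) (x : DTorus d n) :
    charFun d k (discPt d n x)
      = ∏ j, ZMod.stdAddChar (N := 2 * n + 1) ((k j : ZMod (2 * n + 1)) * x j) := by
  have := charFun_grid d n k (fun j => ((x j).val : ℤ))
  have hc : ∀ i, (((x i).val : ℤ) : ZMod (2 * n + 1)) = x i := fun i => by
    rw [Int.cast_natCast, ZMod.natCast_zmod_val]
  simp only [hc] at this
  rw [← this]
  unfold discPt
  simp

lemma charFun_discPt_shift (d n : ℕ) (k : Fin d → ℤ) (x : DTorus d n) (j : Fin d) (m : ℕ) :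
    charFun d k (discPt d n x + ((m : ℝ) * (2 * π / (2 * (n : ℝ) + 1))) • Pi.single j (1 : ℝ))
      = charFun d k (discPt d n (x + m • Pi.single j 1)) := by
  rw [charFun_discPt]
  have := charFun_grid d n k (fun i => ((x i).val : ℤ) + (if i = j then (m : ℤ) else 0))
  refine Eq.trans ?_ (this.trans ?_)
  · congr 1
    funext i
    by_cases h : i = j
    · subst h; simp [discPt]; ring
    · simp [discPt, h]
  · refine Finset.prod_congr rfl fun i _ => ?_
    by_cases h : i = j
    · subst h; simp
    · simp [h]

lemma sum_stdAddChar_Icc (n : ℕ) (b : ZMod (2 * n + 1)) :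
    ∑ k ∈ Finset.Icc (-(n : ℤ)) n, ZMod.stdAddChar (N := 2 * n + 1) ((k : ZMod (2 * n + 1)) * b)
      = if b = 0 then ((2 * n + 1 : ℕ) : ℂ) else 0 := by
  have h := AddChar.sum_mulShift (R := ZMod (2 * n + 1)) b (ZMod.isPrimitive_stdAddChar (2 * n + 1))
  have hinj : Set.InjOn (fun k : ℤ => (k : ZMod (2 * n + 1))) (Finset.Icc (-(n : ℤ)) n) := by
    intro a ha c hc hac
    simp only [Finset.coe_Icc, Set.mem_Icc] at ha hc
    have := (ZMod.intCast_eq_intCast_iff_dvd_sub a c (2 * n + 1)).1 hac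
    have h0 := Int.eq_zero_of_abs_lt_dvd this (by rw [abs_lt]; push_cast; constructor <;> linarith)
    linarith
  have himg : (Finset.Icc (-(n : ℤ)) n).image (fun k : ℤ => (k : ZMod (2 * n + 1))) = Finset.univ := by
    apply Finset.eq_univ_of_card
    rw [Finset.card_image_of_injOn hinj, Int.card_Icc, ZMod.card]
    omega
  rw [← himg, Finset.sum_image hinj] at h
  rw [h, ZMod.card]
  split_ifs <;> simp

lemma char_orth (d n : ℕ) (x y : DTorus d n) :
    ∑ k ∈ cube d n, charFun d k (discPt d n x) * (starRingEnd ℂ) (charFun d k (discPt d n y))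
      = if x = y then ((2 * (n : ℂ) + 1) ^ d) else 0 := by
  simp_rw [charFun_discPt, map_prod, ← AddChar.map_neg_eq_conj, ← Finset.prod_mul_distrib,
    ← AddChar.map_add_eq_mul, ← mul_neg, ← mul_add]
  unfold cube
  rw [← Finset.prod_univ_sum (fun _ => Finset.Icc (-(n : ℤ)) n)
    (fun j (k : ℤ) => ZMod.stdAddChar (N := 2 * n + 1) ((k : ZMod (2 * n + 1)) * (x j + - y j)))]
  simp_rw [sum_stdAddChar_Icc]
  by_cases h : x = y
  · subst h; simp
  · rw [if_neg h]
    obtain ⟨j, hj⟩ := Function.ne_iff.1 h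
    refine Finset.prod_eq_zero (Finset.mem_univ j) ?_
    rw [if_neg]
    rwa [← sub_eq_add_neg, sub_eq_zero]

lemma mem_cube (d n : ℕ) (k : Fin d → ℤ) : k ∈ cube d n ↔ ∀ j, |k j| ≤ (n : ℤ) := by
  simp [cube, abs_le]

lemma exCoef_of_mem {d n : ℕ} (f : DTorus d n → ℂ) {k : Fin d → ℤ} (hk : k ∈ cube d n) :
    exCoef d n f k = dInner d n f (fun x => charFun d k (discPt d n x)) := by
  rw [mem_cube] at hk
  simp [exCoef, hk]

lemma exFun_discPt (d n : ℕ) (f : DTorus d n → ℂ) (x : DTorus d n) :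
    exFun d n f (discPt d n x) = f x := by
  have hN : ((2 * (n : ℂ) + 1) ^ d) ≠ 0 := by
    apply pow_ne_zero; exact_mod_cast Nat.succ_ne_zero (2 * n)
  unfold exFun
  rw [Finset.sum_congr rfl fun k hk => by rw [exCoef_of_mem f hk]]
  unfold dInner
  push_cast
  simp_rw [mul_assoc, ← Finset.mul_sum, Finset.sum_mul]
  rw [Finset.sum_comm]
  have : ∀ y, ∑ k ∈ cube d n, f y * (starRingEnd ℂ) (charFun d k (discPt d n y)) *
      charFun d k (discPt d n x) = f y * if x = y then ((2 * (n : ℂ) + 1) ^ d) else 0 := by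
    intro y
    rw [← char_orth, Finset.mul_sum]
    refine Finset.sum_congr rfl fun k _ => by ring
  simp_rw [this]
  simp
  field_simp

lemma parseval (d n : ℕ) (f : DTorus d n → ℂ) :
    ∑ x, ‖f x‖ ^ 2 = (2 * (n : ℝ) + 1) ^ d * ∑ k ∈ cube d n, ‖exCoef d n f k‖ ^ 2 := by
  have hN : ((2 * (n : ℂ) + 1) ^ d) ≠ 0 := by
    apply pow_ne_zero; exact_mod_cast Nat.succ_ne_zero (2 * n)
  have key : ∑ x, f x * (starRingEnd ℂ) (f x) = (2 * (n : ℂ) + 1) ^ d *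
      ∑ k ∈ cube d n, exCoef d n f k * (starRingEnd ℂ) (exCoef d n f k) := by
    have : ∀ x, f x * (starRingEnd ℂ) (f x) = ∑ k ∈ cube d n,
        exCoef d n f k * (charFun d k (discPt d n x) * (starRingEnd ℂ) (f x)) := by
      intro x
      conv_lhs => rw [← exFun_discPt d n f x]
      rw [exFun_discPt d n f x]
      conv_lhs => rw [← exFun_discPt d n f x, exFun, Finset.sum_mul]
      rw [← exFun, exFun_discPt]
      exact Finset.sum_congr rfl fun k _ => by ring
    simp_rw [this]
    rw [Finset.sum_comm, Finset.mul_sum]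
    refine Finset.sum_congr rfl fun k hk => ?_
    rw [← Finset.mul_sum, mul_left_comm]
    congr 1
    rw [exCoef_of_mem f hk, dInner]
    have hconj : (starRingEnd ℂ) ((((2 * (n : ℝ) + 1) ^ d : ℝ) : ℂ)⁻¹)
        = ((2 * (n : ℂ) + 1) ^ d)⁻¹ := by
      rw [map_inv₀, Complex.conj_ofReal]; push_cast; rfl
    rw [map_mul, hconj, mul_inv_cancel_left₀ hN, map_sum]
    refine Finset.sum_congr rfl fun x _ => ?_
    rw [map_mul, Complex.conj_conj, mul_comm]
  simp_rw [Complex.mul_conj'] at key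
  exact_mod_cast key

/-! ### The difference operator on the Fourier side -/

lemma exCoef_fwdDiff (d n : ℕ) (j : Fin d) (f : DTorus d n → ℂ) (k : Fin d → ℤ) :
    exCoef d n (fwdDiff (Pi.single j 1) f) k
      = (ZMod.stdAddChar (N := 2 * n + 1) (k j) - 1) * exCoef d n f k := by
  by_cases hk : k ∈ cube d n
  swap
  · rw [mem_cube] at hk; simp [exCoef, hk]
  rw [exCoef_of_mem _ hk, exCoef_of_mem _ hk]
  unfold dInner fwdDiff
  rw [mul_left_comm]
  congr 1
  simp_rw [sub_mul, Finset.sum_sub_distrib, one_mul]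
  congr 1
  rw [Finset.mul_sum]
  refine Fintype.sum_equiv (Equiv.addRight (Pi.single j 1)) _ _ fun x => ?_
  simp only [Equiv.coe_addRight]
  have : charFun d k (discPt d n (x + Pi.single j 1))
      = ZMod.stdAddChar (N := 2 * n + 1) (k j) * charFun d k (discPt d n x) := by
    simp_rw [charFun_discPt, Pi.add_apply, mul_add, AddChar.map_add_eq_mul, Finset.prod_mul_distrib]
    rw [mul_comm]
    congr 1
    rw [Finset.prod_eq_single j]
    · simp
    · intro b _ hb; simp [hb]
    · simp
  rw [this, map_mul, ← AddChar.map_neg_eq_conj]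
  have h1 : ZMod.stdAddChar (N := 2 * n + 1) (k j) * ZMod.stdAddChar (N := 2 * n + 1) (- (k j)) = 1 := by
    rw [← AddChar.map_add_eq_mul]; simp
  linear_combination (-f (x + Pi.single j 1) * (starRingEnd ℂ) (charFun d k (discPt d n x))) * h1

lemma exCoef_fwdDiff_iter (d n : ℕ) (j : Fin d) (l : ℕ) (f : DTorus d n → ℂ) (k : Fin d → ℤ) :
    exCoef d n ((fwdDiff (Pi.single j 1))^[l] f) k
      = (ZMod.stdAddChar (N := 2 * n + 1) (k j) - 1) ^ l * exCoef d n f k := by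
  induction l with
  | zero => simp
  | succ l ih => rw [Function.iterate_succ_apply', exCoef_fwdDiff, ih]; ring

lemma stdAddChar_sub_one (n : ℕ) (k : ℤ) :
    ‖ZMod.stdAddChar (N := 2 * n + 1) (k : ZMod (2 * n + 1)) - 1‖
      = 2 * |Real.sin (π / (2 * n + 1) * k)| := by
  rw [ZMod.stdAddChar_coe]
  have := Complex.norm_exp_I_mul_ofReal_sub_one (2 * π / (2 * n + 1) * k)
  convert this using 4
  · push_cast; ring
  · simp
    congr 2; ring

lemma symbol_upper (n : ℕ) (k : ℤ) :
    ‖ZMod.stdAddChar (N := 2 * n + 1) (k : ZMod (2 * n + 1)) - 1‖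
      ≤ (2 * π / (2 * n + 1)) * |(k : ℝ)| := by
  rw [stdAddChar_sub_one]
  have := Real.abs_sin_le_abs (x := π / (2 * n + 1) * k)
  rw [abs_mul, abs_of_pos (by positivity : 0 < π / (2 * (n : ℝ) + 1))] at this
  calc _ ≤ 2 * (π / (2 * n + 1) * |(k : ℝ)|) := by linarith
    _ = _ := by ring

lemma symbol_lower (n : ℕ) (k : ℤ) (hk : |k| ≤ n) :
    (2 * π / (2 * n + 1)) * |(k : ℝ)| ≤
    π / 2 * ‖ZMod.stdAddChar (N := 2 * n + 1) (k : ZMod (2 * n + 1)) - 1‖ := by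
  rw [stdAddChar_sub_one]
  have hk' : |(k : ℝ)| ≤ n := by exact_mod_cast hk
  have hp : 0 < π / (2 * (n : ℝ) + 1) := by positivity
  have hle : |π / (2 * n + 1) * k| ≤ π / 2 := by
    rw [abs_mul, abs_of_pos hp, div_mul_eq_mul_div, div_le_div_iff₀ (by positivity) (by norm_num)]
    nlinarith [Real.pi_pos]
  have := Real.mul_abs_le_abs_sin hle
  rw [abs_mul, abs_of_pos hp] at this
  have h2 := mul_le_mul_of_nonneg_left this Real.pi_pos.le
  calc _ = π * (2 / π * (π / (2 * ↑n + 1) * |(k : ℝ)|)) := by field_simp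
    _ ≤ _ := h2
    _ = _ := by ring

/-! ### Discrete `L²` norm -/

/-- Unnormalised discrete `L²` norm. -/
def l2n (d n : ℕ) (f : DTorus d n → ℂ) : ℝ := ‖(WithLp.toLp 2 f : EuclideanSpace ℂ (DTorus d n))‖

lemma l2n_sq (d n : ℕ) (f : DTorus d n → ℂ) : l2n d n f ^ 2 = ∑ x, ‖f x‖ ^ 2 := by
  rw [l2n, EuclideanSpace.norm_eq, Real.sq_sqrt (by positivity)]

lemma l2n_nonneg (d n : ℕ) (f : DTorus d n → ℂ) : 0 ≤ l2n d n f := norm_nonneg _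

lemma l2n_add (d n : ℕ) (f g : DTorus d n → ℂ) : l2n d n (f + g) ≤ l2n d n f + l2n d n g := by
  unfold l2n; rw [WithLp.toLp_add]; exact norm_add_le _ _

lemma l2n_mul (d n : ℕ) (f g : DTorus d n → ℂ) (A : ℝ) (hA : 0 ≤ A) (hf : ∀ x, ‖f x‖ ≤ A) :
    l2n d n (f * g) ≤ A * l2n d n g := by
  refine abs_le_of_sq_le_sq' ?_ (mul_nonneg hA (l2n_nonneg _ _ _)) |>.2
  rw [mul_pow, l2n_sq, l2n_sq, Finset.mul_sum]
  refine Finset.sum_le_sum fun x _ => ?_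
  rw [Pi.mul_apply, norm_mul, mul_pow]
  gcongr
  exact hf x

lemma l2n_shift (d n : ℕ) (e : DTorus d n) (g : DTorus d n → ℂ) :
    l2n d n (fun x => g (x + e)) = l2n d n g := by
  rw [← sq_eq_sq₀ (l2n_nonneg _ _ _) (l2n_nonneg _ _ _), l2n_sq, l2n_sq]
  exact Fintype.sum_equiv (Equiv.addRight e) _ _ fun x => rfl

lemma fwdDiff_iter_shift {A : Type*} [AddCommGroup A] (e : A) (g : A → ℂ) (l : ℕ) :
    (fwdDiff e)^[l] (fun x => g (x + e)) = fun x => (fwdDiff e)^[l] g (x + e) := by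
  induction l with
  | zero => rfl
  | succ l ih => rw [Function.iterate_succ_apply', ih, Function.iterate_succ_apply']; rfl

lemma l2n_leibniz (d n : ℕ) (e : DTorus d n) (h : ℝ) (hh : 0 ≤ h) (J : ℕ) :
    ∀ (f g : DTorus d n → ℂ) (A B : ℝ), 0 ≤ A → 0 ≤ B →
      (∀ i ≤ J, ∀ x, ‖(fwdDiff e)^[i] f x‖ ≤ A * h ^ i) →
      (∀ i ≤ J, l2n d n ((fwdDiff e)^[i] g) ≤ B * h ^ i) →
      l2n d n ((fwdDiff e)^[J] (f * g)) ≤ 2 ^ J * A * B * h ^ J := by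
  induction J with
  | zero =>
    intro f g A B hA hB hf hg
    have := l2n_mul d n f g A hA (by simpa using hf 0 le_rfl)
    have h2 := hg 0 le_rfl
    simp only [Function.iterate_zero, id, pow_zero, mul_one, one_mul] at h2 ⊢
    exact this.trans (mul_le_mul_of_nonneg_left h2 hA)
  | succ J ih =>
    intro f g A B hA hB hf hg
    have hL : fwdDiff e (f * g) = fwdDiff e f * (fun x => g (x + e)) + f * fwdDiff e g := by
      funext x; simp [fwdDiff]; ring
    have hadd : (fwdDiff e)^[J] (fwdDiff e (f * g)) =
        (fwdDiff e)^[J] (fwdDiff e f * (fun x => g (x + e))) +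
        (fwdDiff e)^[J] (f * fwdDiff e g) := by
      rw [hL, fwdDiff_iter_add]
    rw [Function.iterate_succ_apply, hadd]
    refine (l2n_add _ _ _ _).trans ?_
    have h1 := ih (fwdDiff e f) (fun x => g (x + e)) (A * h) B (by positivity) hB
      (fun i hi x => by
        have := hf (i + 1) (by omega) x
        rw [Function.iterate_succ_apply] at this
        exact this.trans (le_of_eq (by ring)))
      (fun i hi => by
        rw [fwdDiff_iter_shift, l2n_shift]; exact hg i (by omega))
    have h2 := ih f (fwdDiff e g) A (B * h) hA (by positivity)
      (fun i hi x => hf i (by omega) x)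
      (fun i hi => by
        have := hg (i + 1) (by omega)
        rw [Function.iterate_succ_apply] at this
        exact this.trans (le_of_eq (by ring)))
    refine (add_le_add h1 h2).trans (le_of_eq (by ring))

/-! ### Sobolev norm as a finite sum -/

lemma latNormSq_nonneg (d : ℕ) (k : Fin d → ℤ) : 0 ≤ latNormSq d k :=
  Finset.sum_nonneg fun _ _ => sq_nonneg _

lemma sobNormSq_exCoef (d n J : ℕ) (f : DTorus d n → ℂ) :
    sobNormSq d J (exCoef d n f) = ∑ k ∈ cube d n, (1 + latNormSq d k) ^ J * ‖exCoef d n f k‖ ^ 2 := by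
  unfold sobNormSq sobWeight
  simp_rw [Real.rpow_natCast]
  refine tsum_eq_sum fun k hk => ?_
  rw [mem_cube] at hk
  simp [exCoef, hk]

lemma sobNorm_sq (d n J : ℕ) (f : DTorus d n → ℂ) :
    sobNorm d J (exCoef d n f) ^ 2
      = ∑ k ∈ cube d n, (1 + latNormSq d k) ^ J * ‖exCoef d n f k‖ ^ 2 := by
  rw [← sobNormSq_exCoef, sobNorm, Real.sq_sqrt]
  rw [sobNormSq_exCoef]
  refine Finset.sum_nonneg fun k _ => ?_
  have := latNormSq_nonneg d k
  positivity

lemma weight_le (d J : ℕ) (k : Fin d → ℤ) :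
    (1 + latNormSq d k) ^ J ≤ ((d : ℝ) + 1) ^ J * (1 + ∑ j, ((k j : ℝ) ^ 2) ^ J) := by
  let a : Option (Fin d) → ℝ := fun o => o.elim 1 (fun j => (k j : ℝ) ^ 2)
  have ha : ∀ o, 0 ≤ a o := by
    intro o; cases o <;> simp [a]; positivity
  have h1 : 1 + latNormSq d k = ∑ o, a o := by simp [a, Fintype.sum_option, latNormSq]
  have h2 : 1 + ∑ j, ((k j : ℝ) ^ 2) ^ J = ∑ o, a o ^ J := by simp [a, Fintype.sum_option]
  obtain ⟨m, -, hm⟩ := Finset.exists_max_image Finset.univ a ⟨none, Finset.mem_univ _⟩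
  rw [h1, h2]
  have h3 : ∑ o, a o ≤ ((d : ℝ) + 1) * a m := by
    have := Finset.sum_le_card_nsmul Finset.univ a (a m) (fun o ho => hm o ho)
    simpa using this
  calc (∑ o, a o) ^ J ≤ (((d : ℝ) + 1) * a m) ^ J :=
        pow_le_pow_left₀ (Finset.sum_nonneg fun o _ => ha o) h3 J
    _ = ((d : ℝ) + 1) ^ J * a m ^ J := mul_pow _ _ _
    _ ≤ _ := by
      gcongr
      exact Finset.single_le_sum (f := fun o => a o ^ J) (fun o _ => pow_nonneg (ha o) J)
        (Finset.mem_univ m)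

/-- Differences of `g` are controlled by the Sobolev norm of `ex_n g`. -/
lemma l2n_fwdDiff_le (d n J : ℕ) (g : DTorus d n → ℂ) (j : Fin d) (i : ℕ) (hi : i ≤ J) :
    l2n d n ((fwdDiff (Pi.single j 1))^[i] g)
      ≤ (√((2 * (n : ℝ) + 1) ^ d) * sobNorm d J (exCoef d n g)) * (2 * π / (2 * n + 1)) ^ i := by
  have hs : 0 ≤ sobNorm d J (exCoef d n g) := Real.sqrt_nonneg _
  refine abs_le_of_sq_le_sq' ?_ (by positivity) |>.2
  rw [l2n_sq, parseval, mul_pow, mul_pow, Real.sq_sqrt (by positivity), sobNorm_sq, mul_assoc]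
  gcongr
  rw [Finset.sum_mul]
  refine Finset.sum_le_sum fun k _ => ?_
  rw [exCoef_fwdDiff_iter, norm_mul, norm_pow, mul_pow]
  have h1 : (‖ZMod.stdAddChar (N := 2 * n + 1) (k j : ZMod (2 * n + 1)) - 1‖ ^ i) ^ 2
      ≤ (((2 * π / (2 * n + 1)) * |(k j : ℝ)|) ^ i) ^ 2 := by
    gcongr; exact symbol_upper n (k j)
  have h2 : ((k j : ℝ) ^ 2) ^ i ≤ (1 + latNormSq d k) ^ J := by
    have hl := latNormSq_nonneg d k
    calc ((k j : ℝ) ^ 2) ^ i ≤ (1 + latNormSq d k) ^ i := by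
          gcongr
          have : (k j : ℝ) ^ 2 ≤ latNormSq d k :=
            Finset.single_le_sum (f := fun j => (k j : ℝ) ^ 2) (fun _ _ => sq_nonneg _)
              (Finset.mem_univ j)
          linarith
      _ ≤ _ := pow_le_pow_right₀ (by linarith) hi
  calc _ ≤ (((2 * π / (2 * n + 1)) * |(k j : ℝ)|) ^ i) ^ 2 * ‖exCoef d n g k‖ ^ 2 := by gcongr
    _ = ((k j : ℝ) ^ 2) ^ i * ‖exCoef d n g k‖ ^ 2 * ((2 * π / (2 * n + 1)) ^ i) ^ 2 := by
      rw [← sq_abs (k j : ℝ)]; ring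
    _ ≤ _ := by gcongr

/-- Differences of `f` on the grid are controlled by derivatives of `ex_n f`. -/
lemma fwdDiff_grid_le (d n : ℕ) (f : DTorus d n → ℂ) (M : ℝ) (l : ℕ)
    (hM : ∀ y, ‖iteratedFDeriv ℝ l (exFun d n f) y‖ ≤ M) (j : Fin d) (x : DTorus d n) :
    ‖(fwdDiff (Pi.single j 1))^[l] f x‖ ≤ M * (2 * π / (2 * n + 1)) ^ l := by
  let φ : ℝ → ℂ := fun s : ℝ => exFun d n f (discPt d n x + s • Pi.single j (1 : ℝ))
  have hφ : ContDiff ℝ ⊤ φ := (contDiff_exFun d n f).comp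
    (contDiff_const.add (contDiff_id.smul contDiff_const))
  have h := fwdDiff_iter_bound l φ M (2 * π / (2 * n + 1)) (by positivity) hφ
    (iteratedDeriv_line_bound d _ (contDiff_exFun d n f) l M hM j (discPt d n x)) 0
  convert h using 2
  rw [fwdDiff_iter_eq_sum_shift, fwdDiff_iter_eq_sum_shift]
  refine Finset.sum_congr rfl fun m _ => ?_
  congr 1
  rw [← exFun_discPt d n f (x + m • Pi.single j 1)]
  simp only [φ, exFun, zero_add, nsmul_eq_mul, charFun_discPt_shift]

/-- For `J ∈ ℕ₀` there is `C_J > 0` such that for each `f ∈ C^J(T^d)` and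
`g : T_n^d → ℝ`, `‖ex_n(fg)‖_{H_J} ≤ C_J ‖ex_n f‖_{C^J} ‖ex_n g‖_{H_J}`, where `fg`
is the pointwise product of the restrictions to the discrete torus and the
`C^J`-norm of `ex_n f` is encoded by a bound `M` on its derivatives up to order `J`. -/
theorem ex_product_sobolev_estimate (d : ℕ) (J : ℕ) :
    ∃ C > 0, ∀ (n : ℕ) (f g : DTorus d n → ℝ) (M : ℝ),
      (∀ i ≤ J, ∀ y,
          ‖iteratedFDeriv ℝ i (exFun d n (fun x => ((f x : ℝ) : ℂ))) y‖ ≤ M) →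
      sobNorm d J (exCoef d n (fun x => ((f x * g x : ℝ) : ℂ)))
        ≤ C * M * sobNorm d J (exCoef d n (fun x => ((g x : ℝ) : ℂ))) := by
  have hD : (0 : ℝ) < ((d : ℝ) + 1) ^ J * (1 + d * (π ^ J) ^ 2) := by positivity
  refine ⟨√(((d : ℝ) + 1) ^ J * (1 + d * (π ^ J) ^ 2)), Real.sqrt_pos.2 hD, ?_⟩
  intro n f g M hM
  set F : DTorus d n → ℂ := fun x => ((f x : ℝ) : ℂ) with hF
  set G : DTorus d n → ℂ := fun x => ((g x : ℝ) : ℂ) with hG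
  have hFG : (fun x => ((f x * g x : ℝ) : ℂ)) = F * G := by
    funext x; simp [F, G]
  rw [hFG]
  have hM0 : 0 ≤ M := (norm_nonneg _).trans (hM 0 (Nat.zero_le _) 0)
  set S := sobNorm d J (exCoef d n G) with hS
  have hS0 : 0 ≤ S := Real.sqrt_nonneg _
  have hNpos : (0 : ℝ) < (2 * (n : ℝ) + 1) ^ d := by positivity
  set h : ℝ := 2 * π / (2 * n + 1) with hh
  have hhpos : 0 < h := by positivity
  -- the zeroth order part
  have hzero : ∑ k ∈ cube d n, ‖exCoef d n (F * G) k‖ ^ 2 ≤ M ^ 2 * S ^ 2 := by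
    have h1 : l2n d n (F * G) ≤ M * l2n d n G := l2n_mul d n F G M hM0 fun x => by
      have := hM 0 (Nat.zero_le _) (discPt d n x)
      rwa [norm_iteratedFDeriv_zero, exFun_discPt] at this
    have h2 := pow_le_pow_left₀ (l2n_nonneg _ _ _) h1 2
    rw [mul_pow, l2n_sq, l2n_sq, parseval, parseval, mul_left_comm] at h2
    refine (le_of_mul_le_mul_left h2 hNpos).trans ?_
    rw [hS, sobNorm_sq]
    gcongr with k _
    have := one_le_pow₀ (n := J) (by linarith [latNormSq_nonneg d k] : 1 ≤ 1 + latNormSq d k)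
    exact le_mul_of_one_le_left (by positivity) this
  -- the top order part in direction j
  have htop : ∀ j : Fin d, ∑ k ∈ cube d n, ((k j : ℝ) ^ 2) ^ J * ‖exCoef d n (F * G) k‖ ^ 2
      ≤ (π ^ J) ^ 2 * (M ^ 2 * S ^ 2) := by
    intro j
    have h1 := l2n_leibniz d n (Pi.single j 1) h hhpos.le J F G M
      (√((2 * (n : ℝ) + 1) ^ d) * S) hM0 (by positivity)
      (fun i hi x => fwdDiff_grid_le d n F M i (hM i hi) j x)
      (fun i hi => l2n_fwdDiff_le d n J G j i hi)
    have h2 := pow_le_pow_left₀ (l2n_nonneg _ _ _) h1 2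
    rw [l2n_sq, parseval] at h2
    have h3 : (2 ^ J * M * (√((2 * (n : ℝ) + 1) ^ d) * S) * h ^ J) ^ 2
        = (2 * (n : ℝ) + 1) ^ d * ((2 ^ J * M * S * h ^ J) ^ 2) := by
      rw [← Real.sq_sqrt hNpos.le]
      simp only [Real.sqrt_sq (Real.sqrt_nonneg _)]
      ring
    rw [h3] at h2
    have h4 := le_of_mul_le_mul_left h2 hNpos
    have h5 : (h ^ J) ^ 2 * ∑ k ∈ cube d n, ((k j : ℝ) ^ 2) ^ J * ‖exCoef d n (F * G) k‖ ^ 2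
        ≤ ((π / 2) ^ J) ^ 2 * ∑ k ∈ cube d n,
          ‖exCoef d n ((fwdDiff (Pi.single j 1))^[J] (F * G)) k‖ ^ 2 := by
      rw [Finset.mul_sum, Finset.mul_sum]
      refine Finset.sum_le_sum fun k hk => ?_
      rw [exCoef_fwdDiff_iter, norm_mul, norm_pow]
      have hb := symbol_lower n (k j) ((mem_cube d n k).1 hk j)
      have hb2 := pow_le_pow_left₀ (by positivity) (pow_le_pow_left₀ (by positivity) hb J) 2
      calc _ = ((h * |(k j : ℝ)|) ^ J) ^ 2 * ‖exCoef d n (F * G) k‖ ^ 2 := by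
            rw [← sq_abs (k j : ℝ)]; ring
        _ ≤ ((π / 2 * ‖ZMod.stdAddChar (N := 2 * n + 1) (k j : ZMod (2 * n + 1)) - 1‖) ^ J) ^ 2
              * ‖exCoef d n (F * G) k‖ ^ 2 := by gcongr
        _ = _ := by ring
    have h6 : (h ^ J) ^ 2 * ∑ k ∈ cube d n, ((k j : ℝ) ^ 2) ^ J * ‖exCoef d n (F * G) k‖ ^ 2
        ≤ (h ^ J) ^ 2 * ((π ^ J) ^ 2 * (M ^ 2 * S ^ 2)) := by
      refine h5.trans ((mul_le_mul_of_nonneg_left h4 (by positivity)).trans (le_of_eq ?_))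
      have : (π / 2) ^ J * 2 ^ J = π ^ J := by rw [← mul_pow]; congr 1; ring
      rw [← this]; ring
    exact le_of_mul_le_mul_left h6 (by positivity)
  refine abs_le_of_sq_le_sq' ?_ (by positivity) |>.2
  rw [mul_pow, mul_pow, Real.sq_sqrt hD.le, sobNorm_sq]
  calc _ ≤ ∑ k ∈ cube d n, (((d : ℝ) + 1) ^ J * (1 + ∑ j, ((k j : ℝ) ^ 2) ^ J))
          * ‖exCoef d n (F * G) k‖ ^ 2 := by
        gcongr with k _
        exact weight_le d J k
    _ = ((d : ℝ) + 1) ^ J * (∑ k ∈ cube d n, ‖exCoef d n (F * G) k‖ ^ 2 +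
          ∑ j, ∑ k ∈ cube d n, ((k j : ℝ) ^ 2) ^ J * ‖exCoef d n (F * G) k‖ ^ 2) := by
        rw [Finset.sum_comm, ← Finset.sum_add_distrib, Finset.mul_sum]
        refine Finset.sum_congr rfl fun k _ => ?_
        rw [← Finset.sum_mul]; ring
    _ ≤ ((d : ℝ) + 1) ^ J * (M ^ 2 * S ^ 2 + ∑ _j : Fin d, (π ^ J) ^ 2 * (M ^ 2 * S ^ 2)) := by
        gcongr with j _
        exact htop j
    _ = _ := by
        simp only [Finset.sum_const, Finset.card_univ, Fintype.card_fin, nsmul_eq_mul]; ring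

end
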